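/- A translation-invariant set B ⊆ T̃ is biclosed and negation-invariant if and only if there exists a translation- and negation-invariant total order ≺ on ℤ such that B = I(≺) = {(i,j) ∈ T̃ : j ≺ i}. -/

import Mathlib

/-- `T̃ = {(i,j) ∈ ℤ × ℤ : i < j and n ∤ (j - i)}`. -/
def Ttil (n : ℤ) : Set (ℤ × ℤ) := {p | p.1 < p.2 ∧ ¬ (n ∣ (p.2 - p.1))}

/-- `B` is translation-invariant: `(i,j) ∈ B ↔ (i+n, j+n) ∈ B`. -/
def TransInv (n : ℤ) (B : Set (ℤ × ℤ)) : Prop :=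
  ∀ i j : ℤ, (i, j) ∈ B ↔ (i + n, j + n) ∈ B

/-- A translation-invariant subset `B ⊆ T̃` is closed if it satisfies the
three closure conditions of affine type A. -/
def IsClosedT (n : ℤ) (B : Set (ℤ × ℤ)) : Prop :=
  B ⊆ Ttil n ∧
  (∀ i j k : ℤ, i < j → j < k → ¬ (n ∣ (k - i)) →
    (i, j) ∈ B → (j, k) ∈ B → (i, k) ∈ B) ∧
  (∀ i j k : ℤ, i < j → j < k → (n ∣ (k - i)) →
    (i, j) ∈ B → (j, k) ∈ B →
    ∀ l : ℤ, 0 ≤ l → (i, j + l * n) ∈ B ∧ (j, k + l * n) ∈ B) ∧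
  (∀ i j k : ℤ, i < j → j < k → (n ∣ (k - j)) →
    (i, j) ∈ B → (i, k) ∈ B →
    ∀ l : ℤ, 0 ≤ l → j + l * n ≤ k → (i, j + l * n) ∈ B)

/-- `B` is coclosed if `T̃ \ B` is closed. -/
def IsCoclosedT (n : ℤ) (B : Set (ℤ × ℤ)) : Prop :=
  IsClosedT n (Ttil n \ B)

/-- `B` is biclosed if it is both closed and coclosed. -/
def IsBiclosedT (n : ℤ) (B : Set (ℤ × ℤ)) : Prop :=
  IsClosedT n B ∧ IsCoclosedT n B

/-- The negation map on subsets of `T̃`. -/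
def negSet (N : ℤ) (B : Set (ℤ × ℤ)) : Set (ℤ × ℤ) :=
  {p : ℤ × ℤ | p ∈ Ttil N ∧ (-p.2, -p.1) ∈ B}

theorem transInv_mul {N : ℤ} {B : Set (ℤ × ℤ)} (h : TransInv N B) (z i j : ℤ) :
    (i, j) ∈ B ↔ (i + z * N, j + z * N) ∈ B := by
  induction z using Int.induction_on with
  | zero => simp
  | succ k ih =>
    rw [ih, h]
    ring_nf
  | pred k ih =>
    rw [ih, h (i + (-(k : ℤ) - 1) * N)]
    ring_nf

theorem transInv_of_eq {N : ℤ} {B : Set (ℤ × ℤ)} (h : TransInv N B) (z : ℤ) {i j i' j' : ℤ}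
    (hm : (i, j) ∈ B) (hi : i' = i + z * N) (hj : j' = j + z * N) : (i', j') ∈ B := by
  subst hi hj
  exact (transInv_mul h z i j).1 hm

theorem closed_A {N : ℤ} (hN : 0 < N) {B : Set (ℤ × ℤ)} (h : TransInv N B) (hc : IsClosedT N B)
    {i j m c : ℤ} (hij : i < j) (hji : j < i + N) (hm : 0 ≤ m) (hc0 : c < 0)
    (h1 : (i, j + m * N) ∈ B) (h2 : (j + c * N, i) ∈ B) (l : ℤ) (hl : 0 ≤ l) :
    (i, j + (m + l) * N) ∈ B ∧ (j + (c - l) * N, i) ∈ B := by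
  have h3 : (j + m * N, i + (m - c) * N) ∈ B :=
    transInv_of_eq h (m - c) h2 (by ring) (by ring)
  have key := hc.2.2.1 i (j + m * N) (i + (m - c) * N) (by nlinarith) (by nlinarith)
    ⟨m - c, by ring⟩ h1 h3 l hl
  exact ⟨transInv_of_eq h 0 key.1 (by ring) (by ring),
    transInv_of_eq h (c - l - m) key.2 (by ring) (by ring)⟩

theorem closed_Cpos {N : ℤ} (hN : 0 < N) {B : Set (ℤ × ℤ)} (h : TransInv N B)
    (hc : IsClosedT N B) {i j a b c : ℤ} (hij : i < j) (ha : 0 ≤ a) (hab : a < b) (hbc : b < c)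
    (h1 : (i, j + a * N) ∈ B) (h2 : (i, j + c * N) ∈ B) : (i, j + b * N) ∈ B := by
  have key := hc.2.2.2 i (j + a * N) (j + c * N) (by nlinarith) (by nlinarith)
    ⟨c - a, by ring⟩ h1 h2 (b - a) (by omega) (by nlinarith)
  exact transInv_of_eq h 0 key (by ring) (by ring)

theorem closed_Cneg {N : ℤ} (hN : 0 < N) {B : Set (ℤ × ℤ)} (h : TransInv N B)
    (hc : IsClosedT N B) {i j a b c : ℤ} (hij : j < i + N) (hab : a < b) (hbc : b < c)
    (hc0 : c < 0)
    (h1 : (j + a * N, i) ∈ B) (h2 : (j + c * N, i) ∈ B) : (j + b * N, i) ∈ B := by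
  have h1' : (j, i + (-a) * N) ∈ B := transInv_of_eq h (-a) h1 (by ring) (by ring)
  have h2' : (j, i + (-c) * N) ∈ B := transInv_of_eq h (-c) h2 (by ring) (by ring)
  have key := hc.2.2.2 j (i + (-c) * N) (i + (-a) * N) (by nlinarith) (by nlinarith)
    ⟨c - a, by ring⟩ h2' h1' (c - b) (by omega) (by nlinarith)
  exact transInv_of_eq h b key (by ring) (by ring)

/-- a boolean function with the convexity properties cannot both rise and drop -/
theorem no_rise_drop (f : ℤ → Prop)
    (A : ∀ m c, 0 ≤ m → c < 0 → f m → ¬ f c → ∀ l, 0 ≤ l → f (m + l) ∧ ¬ f (c - l))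
    (A' : ∀ m c, 0 ≤ m → c < 0 → ¬ f m → f c → ∀ l, 0 ≤ l → ¬ f (m + l) ∧ f (c - l))
    (P : ∀ a b c, 0 ≤ a → a < b → b < c → f a → f c → f b)
    (P' : ∀ a b c, 0 ≤ a → a < b → b < c → ¬ f a → ¬ f c → ¬ f b)
    (Q : ∀ a b c, a < b → b < c → c < 0 → f a → f c → f b)
    (Q' : ∀ a b c, a < b → b < c → c < 0 → ¬ f a → ¬ f c → ¬ f b)
    (p q : ℤ) (hp : f p) (hp' : ¬ f (p - 1)) (hq : ¬ f q) (hq' : f (q - 1)) : False := by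
  have hne : p ≠ q := by rintro rfl; exact hq hp
  rcases lt_trichotomy p 0 with p0 | p0 | p0
  · rcases le_or_gt 0 q with q0 | q0
    · rcases eq_or_lt_of_le q0 with q0 | q0
      · subst q0
        have := (A' 0 (-1) le_rfl (by omega) hq (by simpa using hq') (-p) (by omega)).2
        rw [show (-1 : ℤ) - -p = p - 1 by ring] at this
        exact hp' this
      · have := (A (q - 1) (p - 1) (by omega) (by omega) hq' hp' 1 (by omega)).1
        rw [show q - 1 + 1 = q by ring] at this
        exact hq this
    · rcases lt_or_gt_of_ne hne with h | h
      · rcases eq_or_ne p (q - 1) with e | e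
        · exact Q' (p - 1) p q (by omega) (by omega) q0 hp' hq hp
        · exact Q' (p - 1) p q (by omega) (by omega) q0 hp' hq hp
      · exact hq (Q (q - 1) q p (by omega) (by omega) p0 hq' hp)
  · subst p0
    rcases le_or_gt 0 q with q0 | q0
    · have := (A 0 (-1) le_rfl (by omega) hp (by simpa using hp') q q0).1
      rw [zero_add] at this
      exact hq this
    · have := (A 0 (-1) le_rfl (by omega) hp (by simpa using hp') (-q) (by omega)).2
      rw [show (-1 : ℤ) - -q = q - 1 by ring] at this
      exact this hq'
  · rcases le_or_gt q 0 with q0 | q0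
    · rcases eq_or_lt_of_le q0 with q0 | q0
      · subst q0
        have := (A' 0 (-1) le_rfl (by omega) hq (by simpa using hq') p (by omega)).1
        rw [zero_add] at this
        exact this hp
      · exact (A p q (by omega) (by omega) hp hq 1 (by omega)).2 hq'
    · rcases lt_or_gt_of_ne hne with h | h
      · exact P' (p - 1) p q (by omega) (by omega) h hp' hq hp
      · exact hq (P (q - 1) q p (by omega) (by omega) h hq' hp)

/-- the relation on noncongruent pairs -/
def sRel (B : Set (ℤ × ℤ)) (i j : ℤ) : Prop := (i < j ∧ (i, j) ∉ B) ∨ (j < i ∧ (j, i) ∈ B)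

def cg (N i j : ℤ) : Prop := N ∣ j - i

theorem cg_refl (N i : ℤ) : cg N i i := by simp [cg]
theorem cg_symm {N i j : ℤ} (h : cg N i j) : cg N j i := by
  unfold cg at *; rw [← neg_sub]; exact (dvd_neg).2 h
theorem cg_trans {N i j k : ℤ} (h : cg N i j) (h' : cg N j k) : cg N i k := by
  unfold cg at *; have := dvd_add h h'; rwa [show j - i + (k - j) = k - i by ring] at this
theorem cg_mul (N i z : ℤ) : cg N i (i + z * N) := ⟨z, by ring⟩
theorem cg_add (N i : ℤ) : cg N i (i + N) := ⟨1, by ring⟩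
theorem cg_shift {N i j : ℤ} : cg N (i + N) (j + N) ↔ cg N i j := by
  unfold cg; rw [show j + N - (i + N) = j - i by ring]
theorem cg_neg {N i j : ℤ} : cg N (-j) (-i) ↔ cg N i j := by
  unfold cg; rw [show -i - -j = j - i by ring]

theorem sRel_mul {N : ℤ} {B : Set (ℤ × ℤ)} (h : TransInv N B) (z i j : ℤ) :
    sRel B i j ↔ sRel B (i + z * N) (j + z * N) := by
  unfold sRel
  rw [transInv_mul h z i j, transInv_mul h z j i]
  simp

theorem sRel_of_eq {N : ℤ} {B : Set (ℤ × ℤ)} (h : TransInv N B) (z : ℤ) {i j i' j' : ℤ}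
    (hm : sRel B i j) (hi : i' = i + z * N) (hj : j' = j + z * N) : sRel B i' j' := by
  subst hi hj
  exact (sRel_mul h z i j).1 hm

theorem sRel_asymm {B : Set (ℤ × ℤ)} {i j : ℤ} (h : sRel B i j) : ¬ sRel B j i := by
  unfold sRel at *; grind

theorem sRel_total {B : Set (ℤ × ℤ)} {i j : ℤ} (h : i ≠ j) : sRel B i j ∨ sRel B j i := by
  unfold sRel at *; grind

theorem compl_transInv {N : ℤ} {B : Set (ℤ × ℤ)} (h : TransInv N B) :
    TransInv N (Ttil N \ B) := by
  intro i j
  have := h i j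
  simp only [Ttil, Set.mem_diff, Set.mem_setOf_eq, add_lt_add_iff_right]
  rw [this, show j + N - (i + N) = j - i by ring]

theorem sRel_trans {N : ℤ} {B : Set (ℤ × ℤ)} (hb : IsBiclosedT N B) {i j k : ℤ}
    (hij : ¬ cg N i j) (hjk : ¬ cg N j k) (hik : ¬ cg N i k)
    (h1 : sRel B i j) (h2 : sRel B j k) : sRel B i k := by
  have c1 := hb.1.2.1
  have d1 : ∀ i j k : ℤ, i < j → j < k → ¬ cg N i k → ¬ cg N i j → ¬ cg N j k →
      (i, j) ∉ B → (j, k) ∉ B → (i, k) ∉ B := by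
    intro i j k h1 h2 h3 h4 h5 h6 h7
    exact (hb.2.2.1 i j k h1 h2 h3 ⟨⟨h1, h4⟩, h6⟩ ⟨⟨h2, h5⟩, h7⟩).2
  have c1' : ∀ i j k : ℤ, i < j → j < k → ¬ cg N i k →
      (i, j) ∈ B → (j, k) ∈ B → (i, k) ∈ B := c1
  have s1 : ¬ cg N j i := fun h => hij (cg_symm h)
  have s2 : ¬ cg N k j := fun h => hjk (cg_symm h)
  have s3 : ¬ cg N k i := fun h => hik (cg_symm h)
  have ne : i ≠ k := by rintro rfl; exact hik (cg_refl _ _)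
  rcases sRel_total (B := B) ne with h | h
  · exact h
  · exfalso
    rcases h1 with ⟨a1, b1⟩ | ⟨a1, b1⟩ <;> rcases h2 with ⟨a2, b2⟩ | ⟨a2, b2⟩ <;>
      rcases h with ⟨a3, b3⟩ | ⟨a3, b3⟩
    · omega
    · exact d1 i j k a1 a2 hik hij hjk b1 b2 b3
    · exact d1 k i j a3 a1 s2 s3 hij b3 b1 b2
    · exact b1 (c1' i k j a3 a2 hij b3 b2)
    · exact d1 j k i a2 a3 s1 hjk s3 b2 b3 b1
    · exact b2 (c1' j i k a1 a3 hjk b1 b3)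
    · exact b3 (c1' k j i a2 a1 s3 b2 b1)
    · omega

/-- the waning classes -/
def wan (N : ℤ) (B : Set (ℤ × ℤ)) (i : ℤ) : Prop :=
  ∃ j, ¬ cg N i j ∧ sRel B (i + N) j ∧ sRel B j i

/-- the (forced) waxing classes -/
def wax (N : ℤ) (B : Set (ℤ × ℤ)) (i : ℤ) : Prop :=
  ∃ j, ¬ cg N i j ∧ sRel B i j ∧ sRel B j (i + N)

theorem wan_mul {N : ℤ} {B : Set (ℤ × ℤ)} (h : TransInv N B) (z i : ℤ) (hw : wan N B i) :
    wan N B (i + z * N) := by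
  obtain ⟨j, h1, h2, h3⟩ := hw
  refine ⟨j + z * N, fun hc => h1 ?_, sRel_of_eq h z h2 (by ring) (by ring),
    sRel_of_eq h z h3 (by ring) (by ring)⟩
  exact cg_trans (cg_trans (cg_mul N i z) hc) (cg_symm (cg_mul N j z))

theorem wan_cg {N : ℤ} {B : Set (ℤ × ℤ)} (h : TransInv N B) {i j : ℤ} (hc : cg N i j) :
    wan N B i ↔ wan N B j := by
  obtain ⟨z, hz⟩ := hc
  constructor
  · intro hw
    have := wan_mul h z i hw
    rwa [show i + z * N = j by linarith] at this
  · intro hw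
    have := wan_mul h (-z) j hw
    rwa [show j + -z * N = i by linarith] at this

theorem not_wan_wax_same {N : ℤ} (hN : 0 < N) {B : Set (ℤ × ℤ)} (h : TransInv N B)
    (hb : IsBiclosedT N B) {i j : ℤ} (hij : i < j) (hji : j < i + N) (p q : ℤ)
    (h1 : sRel B (i + N) (j + p * N)) (h2 : sRel B (j + p * N) i)
    (h3 : sRel B i (j + q * N)) (h4 : sRel B (j + q * N) (i + N)) : False := by
  have hT := compl_transInv h
  have hn : ¬ cg N i j := by
    intro hc
    obtain ⟨c, hc⟩ := hc
    have : 0 < c := by nlinarith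
    nlinarith
  have hnm : ∀ m, ¬ N ∣ j + m * N - i := fun m hc =>
    hn (cg_trans hc (cg_symm (cg_mul N j m)))
  have hnm' : ∀ m, ¬ N ∣ i - (j + m * N) := fun m hc =>
    hnm m (cg_symm hc)
  have hpos : ∀ m, 0 ≤ m → i < j + m * N := fun m hm => by nlinarith
  have hneg : ∀ m, m < 0 → j + m * N < i := fun m hm => by nlinarith
  have fpos : ∀ m, 0 ≤ m → (sRel B (j + m * N) i ↔ (i, j + m * N) ∈ B) := fun m hm => by
    have := hpos m hm
    unfold sRel; constructor
    · rintro (h | h)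
      · omega
      · exact h.2
    · intro h; exact Or.inr ⟨this, h⟩
  have fneg : ∀ m, m < 0 → (¬ sRel B (j + m * N) i ↔ (j + m * N, i) ∈ B) := fun m hm => by
    have := hneg m hm
    unfold sRel; constructor
    · intro h; by_contra h'; exact h (Or.inl ⟨this, h'⟩)
    · rintro h1 (h | h)
      · exact h.2 h1
      · omega
  have gpos : ∀ m, 0 ≤ m → (¬ sRel B (j + m * N) i ↔ (i, j + m * N) ∈ Ttil N \ B) :=
    fun m hm => by
      rw [fpos m hm]
      exact ⟨fun h => ⟨⟨hpos m hm, hnm m⟩, h⟩, fun h => h.2⟩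
  have gneg : ∀ m, m < 0 → (sRel B (j + m * N) i ↔ (j + m * N, i) ∈ Ttil N \ B) :=
    fun m hm => by
      have := fneg m hm
      constructor
      · exact fun h => ⟨⟨hneg m hm, hnm' m⟩, fun h' => this.2 h' h⟩
      · intro h
        by_contra h'
        exact h.2 (this.1 h')
  refine no_rise_drop (fun m => sRel B (j + m * N) i) ?_ ?_ ?_ ?_ ?_ ?_ p q h2 ?_ ?_ ?_
  · intro m c hm hc a b l hl
    have := closed_A hN h hb.1 hij hji hm hc ((fpos m hm).1 a) ((fneg c hc).1 b) l hl
    exact ⟨(fpos _ (by omega)).2 this.1, (fneg _ (by omega)).2 this.2⟩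
  · intro m c hm hc a b l hl
    have := closed_A hN hT hb.2 hij hji hm hc ((gpos m hm).1 a) ((gneg c hc).1 b) l hl
    exact ⟨(gpos _ (by omega)).2 this.1, (gneg _ (by omega)).2 this.2⟩
  · intro a b c ha hab hbc x y
    exact (fpos b (by omega)).2 (closed_Cpos hN h hb.1 hij ha hab hbc
      ((fpos a (by omega)).1 x) ((fpos c (by omega)).1 y))
  · intro a b c ha hab hbc x y
    exact (gpos b (by omega)).2 (closed_Cpos hN hT hb.2 hij ha hab hbc
      ((gpos a (by omega)).1 x) ((gpos c (by omega)).1 y))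
  · intro a b c hab hbc hc x y
    exact (gneg b (by omega)).2 (closed_Cneg hN hT hb.2 hji hab hbc hc
      ((gneg a (by omega)).1 x) ((gneg c (by omega)).1 y))
  · intro a b c hab hbc hc x y
    exact (fneg b (by omega)).2 (closed_Cneg hN h hb.1 hji hab hbc hc
      ((fneg a (by omega)).1 x) ((fneg c (by omega)).1 y))
  · exact sRel_asymm (sRel_of_eq h (-1) h1 (by ring) (by ring))
  · exact sRel_asymm h3
  · exact sRel_of_eq h (-1) h4 (by ring) (by ring)

theorem not_wan_wax {N : ℤ} (hN : 0 < N) {B : Set (ℤ × ℤ)} (h : TransInv N B)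
    (hb : IsBiclosedT N B) {i : ℤ} (hw : wan N B i) (hx : wax N B i) : False := by
  obtain ⟨j, n1, a1, a2⟩ := hw
  obtain ⟨k, n2, b1, b2⟩ := hx
  have n1' : ¬ cg N j i := fun hc => n1 (cg_symm hc)
  have n2' : ¬ cg N k i := fun hc => n2 (cg_symm hc)
  by_cases hjk : cg N j k
  · have hd := Int.emod_add_mul_ediv (j - i) N
    have h0 := Int.emod_nonneg (j - i) hN.ne'
    have h1 := Int.emod_lt_of_pos (j - i) hN
    have h2 : (j - i) % N ≠ 0 := fun h => n1 (Int.dvd_of_emod_eq_zero h)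
    obtain ⟨z, hz⟩ := hjk
    set e := (j - i) % N
    set d := (j - i) / N
    have ej : j = (i + e) + d * N := by linarith
    have ek : k = (i + e) + (d + z) * N := by linarith
    rw [ej] at a1 a2
    rw [ek] at b1 b2
    exact not_wan_wax_same hN h hb (by omega) (by omega) d (d + z) a1 a2 b1 b2
  · have hkj : ¬ cg N k j := fun hc => hjk (cg_symm hc)
    have x := sRel_trans hb n1' n2 hjk a2 b1
    have y := sRel_trans hb (fun hc => n2' (cg_trans hc (cg_symm (cg_add N i))))
      (fun hc => n1 (cg_trans (cg_add N i) hc)) hkj b2 a1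
    exact sRel_asymm x y

theorem descent_wan {N : ℤ} {B : Set (ℤ × ℤ)} (h : TransInv N B) (p : ℕ) :
    ∀ i j : ℤ, ¬ cg N i j → sRel B (i + ((p : ℤ) + 1) * N) j → sRel B j i → wan N B i := by
  induction p with
  | zero =>
    intro i j n h1 h2
    exact ⟨j, n, by simpa using h1, h2⟩
  | succ p ih =>
    intro i j n h1 h2
    have n' : ¬ cg N (i + N) j := fun hc => n (cg_trans (cg_add N i) hc)
    have ne : i + N ≠ j := by rintro rfl; exact n' (cg_refl _ _)
    rcases sRel_total (B := B) ne with hh | hh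
    · exact ⟨j, n, hh, h2⟩
    · rw [wan_cg h (cg_add N i)]
      refine ih (i + N) j n' ?_ hh
      rwa [show i + N + ((p : ℤ) + 1) * N = i + (((p + 1 : ℕ) : ℤ) + 1) * N by push_cast; ring]

theorem descent_wax {N : ℤ} {B : Set (ℤ × ℤ)} (h : TransInv N B) (p : ℕ) :
    ∀ i j : ℤ, ¬ cg N i j → sRel B i j → sRel B j (i + ((p : ℤ) + 1) * N) →
      ∃ i', cg N i i' ∧ wax N B i' := by
  induction p with
  | zero =>
    intro i j n h1 h2
    exact ⟨i, cg_refl _ _, j, n, h1, by simpa using h2⟩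
  | succ p ih =>
    intro i j n h1 h2
    have n' : ¬ cg N (i + N) j := fun hc => n (cg_trans (cg_add N i) hc)
    have ne : i + N ≠ j := by rintro rfl; exact n' (cg_refl _ _)
    rcases sRel_total (B := B) ne with hh | hh
    · obtain ⟨i', c, w⟩ := ih (i + N) j n' hh (by
        rwa [show i + N + ((p : ℤ) + 1) * N = i + (((p + 1 : ℕ) : ℤ) + 1) * N by push_cast; ring])
      exact ⟨i', cg_trans (cg_add N i) c, w⟩
    · exact ⟨i, cg_refl _ _, j, n, h1, hh⟩

/-- the total order -/
def rRel (N : ℤ) (B : Set (ℤ × ℤ)) (i j : ℤ) : Prop :=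
  (¬ cg N i j ∧ sRel B i j) ∨
    (cg N i j ∧ ((wan N B i ∧ j < i) ∨ (¬ wan N B i ∧ i < j)))

theorem key_rRel {N : ℤ} (hN : 0 < N) {B : Set (ℤ × ℤ)} (h : TransInv N B)
    (hb : IsBiclosedT N B) {i j k : ℤ} (hc : cg N i k) (hn : ¬ cg N i j)
    (h1 : sRel B i j) (h2 : sRel B j k) : rRel N B i k := by
  refine Or.inr ⟨hc, ?_⟩
  obtain ⟨z, hz⟩ := hc
  rcases lt_trichotomy i k with hik | hik | hik
  · right
    refine ⟨fun hw => ?_, hik⟩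
    have hz0 : 0 < z := by nlinarith
    obtain ⟨p, hp⟩ := Int.eq_ofNat_of_zero_le (show 0 ≤ z - 1 by omega)
    have hk : k = i + ((p : ℤ) + 1) * N := by rw [← hp]; linarith
    rw [hk] at h2
    obtain ⟨i', c, w⟩ := descent_wax h p i j hn h1 h2
    exact not_wan_wax hN h hb ((wan_cg h c).1 hw) w
  · subst hik
    exact absurd h2 (sRel_asymm h1)
  · left
    refine ⟨?_, hik⟩
    have hz0 : z < 0 := by nlinarith
    obtain ⟨p, hp⟩ := Int.eq_ofNat_of_zero_le (show 0 ≤ -z - 1 by omega)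
    have hi : i = k + ((p : ℤ) + 1) * N := by rw [← hp]; linarith
    have hc : cg N k i := ⟨-z, by linarith⟩
    rw [← wan_cg h hc]
    rw [hi] at h1
    exact descent_wan h p k j (fun hh => hn (cg_trans (cg_symm hc) hh)) h1 h2

theorem rRel_asymm {N : ℤ} {B : Set (ℤ × ℤ)} (h : TransInv N B) {i j : ℤ}
    (h1 : rRel N B i j) : ¬ rRel N B j i := by
  intro h2
  rcases h1 with ⟨a, b⟩ | ⟨a, b⟩ <;> rcases h2 with ⟨c, d⟩ | ⟨c, d⟩
  · exact sRel_asymm b d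
  · exact a (cg_symm c)
  · exact c (cg_symm a)
  · rw [wan_cg h a] at b
    rcases b with ⟨b, b'⟩ | ⟨b, b'⟩ <;> rcases d with ⟨d, d'⟩ | ⟨d, d'⟩
    · omega
    · exact d b
    · exact b d
    · omega

theorem rRel_total {N : ℤ} {B : Set (ℤ × ℤ)} (h : TransInv N B) {i j : ℤ}
    (hne : i ≠ j) : rRel N B i j ∨ rRel N B j i := by
  by_cases hc : cg N i j
  · have hw := wan_cg h hc
    have hc' := cg_symm hc
    unfold rRel
    by_cases w : wan N B i
    · have w' := hw.1 w
      rcases lt_or_gt_of_ne hne with h | h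
      · exact Or.inr (Or.inr ⟨hc', Or.inl ⟨w', h⟩⟩)
      · exact Or.inl (Or.inr ⟨hc, Or.inl ⟨w, h⟩⟩)
    · have w' := fun x => w (hw.2 x)
      rcases lt_or_gt_of_ne hne with h | h
      · exact Or.inl (Or.inr ⟨hc, Or.inr ⟨w, h⟩⟩)
      · exact Or.inr (Or.inr ⟨hc', Or.inr ⟨w', h⟩⟩)
  · rcases sRel_total (B := B) hne with h | h
    · exact Or.inl (Or.inl ⟨hc, h⟩)
    · exact Or.inr (Or.inl ⟨fun h => hc (cg_symm h), h⟩)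

theorem rRel_trans {N : ℤ} (hN : 0 < N) {B : Set (ℤ × ℤ)} (h : TransInv N B)
    (hb : IsBiclosedT N B) {i j k : ℤ} (h1 : rRel N B i j) (h2 : rRel N B j k) :
    rRel N B i k := by
  rcases h1 with ⟨a, b⟩ | ⟨a, b⟩ <;> rcases h2 with ⟨c, d⟩ | ⟨c, d⟩
  · by_cases hc : cg N i k
    · exact key_rRel hN h hb hc a b d
    · exact Or.inl ⟨hc, sRel_trans hb a c hc b d⟩
  · -- j ≡ k
    have n : ¬ cg N i k := fun hh => a (cg_trans hh (cg_symm c))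
    have n' : ¬ cg N k i := fun hh => n (cg_symm hh)
    have ne : i ≠ k := by rintro rfl; exact n (cg_refl _ _)
    rcases sRel_total (B := B) ne with x | x
    · exact Or.inl ⟨n, x⟩
    · exact absurd (Or.inr ⟨c, d⟩) (rRel_asymm h (key_rRel hN h hb (cg_symm c) n' x b))
  · have n : ¬ cg N i k := fun hh => c (cg_trans (cg_symm a) hh)
    have ne : i ≠ k := by rintro rfl; exact n (cg_refl _ _)
    rcases sRel_total (B := B) ne with x | x
    · exact Or.inl ⟨n, x⟩
    · exact absurd (Or.inr ⟨a, b⟩) (rRel_asymm h (key_rRel hN h hb (cg_symm a) c d x))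
  · rw [← wan_cg h a] at d
    refine Or.inr ⟨cg_trans a c, ?_⟩
    rcases b with ⟨b, b'⟩ | ⟨b, b'⟩ <;> rcases d with ⟨d, d'⟩ | ⟨d, d'⟩
    · exact Or.inl ⟨b, by omega⟩
    · exact absurd b d
    · exact absurd d b
    · exact Or.inr ⟨b, by omega⟩

theorem sRel_neg {N : ℤ} {B : Set (ℤ × ℤ)} (hs : negSet N B = B) (hB : B ⊆ Ttil N) {i j : ℤ}
    (hm : sRel B i j) : sRel B (-j) (-i) := by
  have key : ∀ a b : ℤ, (a, b) ∈ B → (-b, -a) ∈ B := by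
    intro a b hab
    rw [← hs] at hab
    exact hab.2
  rcases hm with ⟨a, b⟩ | ⟨a, b⟩
  · left
    refine ⟨by omega, fun hh => b ?_⟩
    simpa using key _ _ hh
  · exact Or.inr ⟨by omega, key _ _ b⟩

theorem wan_neg {N : ℤ} {B : Set (ℤ × ℤ)} (h : TransInv N B) (hs : negSet N B = B)
    (hB : B ⊆ Ttil N) {i : ℤ} (hw : wan N B i) : wan N B (-i) := by
  obtain ⟨j, a, b, c⟩ := hw
  refine ⟨-j + N, fun hh => a ?_, sRel_of_eq h 1 (sRel_neg hs hB c) (by ring) (by ring),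
    sRel_of_eq h 1 (sRel_neg hs hB b) (by ring) (by ring)⟩
  exact cg_symm (cg_neg.1 (cg_trans hh (cg_symm (cg_add N (-j)))))

theorem rRel_neg {N : ℤ} {B : Set (ℤ × ℤ)} (h : TransInv N B) (hs : negSet N B = B)
    (hB : B ⊆ Ttil N) {i j : ℤ} (hr : rRel N B i j) : rRel N B (-j) (-i) := by
  rcases hr with ⟨a, b⟩ | ⟨a, b⟩
  · exact Or.inl ⟨fun hh => a (cg_neg.1 hh), sRel_neg hs hB b⟩
  · refine Or.inr ⟨cg_neg.2 a, ?_⟩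
    rw [wan_cg h a] at b
    rcases b with ⟨b, b'⟩ | ⟨b, b'⟩
    · exact Or.inl ⟨wan_neg h hs hB b, by omega⟩
    · refine Or.inr ⟨fun hh => b ?_, by omega⟩
      simpa using wan_neg h hs hB hh

/-- inversion sets of translation invariant orders are closed -/
theorem closed_of_order {N : ℤ} (hN : 0 < N) (r : ℤ → ℤ → Prop) (irr : ∀ i, ¬ r i i)
    (tr : ∀ i j k, r i j → r j k → r i k) (tot : ∀ i j, i ≠ j → r i j ∨ r j i)
    (ht : ∀ i j : ℤ, r i j ↔ r (i + N) (j + N)) :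
    IsClosedT N {p : ℤ × ℤ | p ∈ Ttil N ∧ r p.2 p.1} := by
  have htm : ∀ z i j : ℤ, r i j ↔ r (i + z * N) (j + z * N) := fun z i j =>
    transInv_mul (B := {p : ℤ × ℤ | r p.1 p.2}) ht z i j
  have mono1 : ∀ (i : ℤ) (p : ℕ), r i (i + N) → r i (i + ((p : ℤ) + 1) * N) := by
    intro i p h
    induction p with
    | zero => simpa using h
    | succ p ih =>
      refine tr _ _ _ ih ?_
      have := (htm ((p : ℤ) + 1) _ _).1 h
      rwa [show i + N + ((p : ℤ) + 1) * N = i + (((p + 1 : ℕ) : ℤ) + 1) * N by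
        push_cast; ring] at this
  have mono2 : ∀ (i : ℤ) (p : ℕ), r (i + N) i → r (i + ((p : ℤ) + 1) * N) i := by
    intro i p h
    induction p with
    | zero => simpa using h
    | succ p ih =>
      refine tr _ _ _ ?_ ih
      have := (htm ((p : ℤ) + 1) _ _).1 h
      rwa [show i + N + ((p : ℤ) + 1) * N = i + (((p + 1 : ℕ) : ℤ) + 1) * N by
        push_cast; ring] at this
  have up : ∀ i z : ℤ, r i (i + N) → 0 < z → r i (i + z * N) := by
    intro i z h hz
    obtain ⟨p, hp⟩ := Int.eq_ofNat_of_zero_le (show 0 ≤ z - 1 by omega)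
    have := mono1 i p h
    rwa [show (p : ℤ) + 1 = z by omega] at this
  have dn : ∀ i z : ℤ, r (i + N) i → 0 < z → r (i + z * N) i := by
    intro i z h hz
    obtain ⟨p, hp⟩ := Int.eq_ofNat_of_zero_le (show 0 ≤ z - 1 by omega)
    have := mono2 i p h
    rwa [show (p : ℤ) + 1 = z by omega] at this
  have dn' : ∀ i z l : ℤ, 0 < z → r (i + z * N) i → 0 < l → r (i + l * N) i := by
    intro i z l hz h hl
    refine dn i l ?_ hl
    rcases tot i (i + N) (by omega) with hh | hh
    · exact absurd (tr _ _ _ (up i z hh hz) h) (irr _)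
    · exact hh
  have ndm : ∀ i j l : ℤ, ¬ N ∣ j - i → ¬ N ∣ j + l * N - i := fun i j l h hh =>
    h (cg_trans (N := N) (i := i) (j := j + l * N) (k := j) hh (cg_symm (cg_mul N j l)))
  refine ⟨fun p hp => hp.1, ?_, ?_, ?_⟩
  · rintro i j k hij hjk hn ⟨-, a⟩ ⟨-, b⟩
    exact ⟨⟨hij.trans hjk, hn⟩, tr _ _ _ b a⟩
  · rintro i j k hij hjk ⟨z, hz⟩ ⟨⟨-, a'⟩, a⟩ ⟨⟨-, b'⟩, b⟩ l hl
    simp only at a a' b b'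
    have hz0 : 0 < z := by nlinarith
    have hk : k = i + z * N := by linarith
    have w1 : r (i + z * N) i := by rw [← hk]; exact tr _ _ _ b a
    have w2 : r (j + z * N) j := by
      refine tr _ _ _ ((htm z _ _).1 a) ?_
      rw [← hk]; exact b
    have hlN : 0 ≤ l * N := by positivity
    refine ⟨⟨⟨by simp only; omega, ndm _ _ _ a'⟩, ?_⟩, ⟨⟨by simp only; omega, ndm _ _ _ b'⟩, ?_⟩⟩
    · simp only
      rcases eq_or_lt_of_le hl with e | e
      · subst e; simpa using a
      · exact tr _ _ _ (dn' j z l hz0 w2 e) a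
    · simp only
      rcases eq_or_lt_of_le hl with e | e
      · subst e; simpa using b
      · refine tr _ _ _ ?_ b
        have := (htm z _ _).1 (dn' i z l hz0 w1 e)
        rw [hk]
        rwa [show i + l * N + z * N = i + z * N + l * N by ring] at this
  · rintro i j k hij hjk ⟨z, hz⟩ ⟨⟨-, a'⟩, a⟩ ⟨⟨-, b'⟩, b⟩ l hl hlk
    simp only at a a' b b'
    have hlN : 0 ≤ l * N := by positivity
    refine ⟨⟨by simp only; omega, ndm _ _ _ a'⟩, ?_⟩
    simp only
    have hk : k = j + z * N := by linarith
    rcases eq_or_lt_of_le hl with e | e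
    · subst e; simpa using a
    · rcases tot j (j + N) (by omega) with hh | hh
      · have hlz : l ≤ z := by
          by_contra hc
          nlinarith
        rcases eq_or_lt_of_le hlz with e' | e'
        · subst e'; rwa [← hk]
        · refine tr _ _ _ ?_ b
          have := (htm l _ _).1 (up j (z - l) hh (by omega))
          rw [hk]
          rwa [show j + (z - l) * N + l * N = j + z * N by ring] at this
      · exact tr _ _ _ (dn j l hh e) a

/-- With `N = 2n+1`, a translation-invariant set `B ⊆ T̃` is biclosed and
negation-invariant if and only if it is the inversion set of a translation- and
negation-invariant total order on `ℤ`. -/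
theorem neg_biclosed_iff_exists_symmetric_order (n : ℤ) (hn : 1 ≤ n)
    (B : Set (ℤ × ℤ)) (hB : B ⊆ Ttil (2 * n + 1))
    (hBt : TransInv (2 * n + 1) B) :
    (IsBiclosedT (2 * n + 1) B ∧ negSet (2 * n + 1) B = B) ↔
      ∃ r : ℤ → ℤ → Prop, IsStrictTotalOrder ℤ r ∧
        (∀ i j : ℤ, r i j ↔ r (i + (2 * n + 1)) (j + (2 * n + 1))) ∧
        (∀ i j : ℤ, r i j ↔ r (-j) (-i)) ∧
        B = {p : ℤ × ℤ | p ∈ Ttil (2 * n + 1) ∧ r p.2 p.1} := by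
  have hN : 0 < 2 * n + 1 := by omega
  generalize 2 * n + 1 = N at *
  constructor
  · rintro ⟨hb, hs⟩
    refine ⟨rRel N B, ?_, ?_, ?_, ?_⟩
    · refine { trichotomous := ?_, irrefl := ?_, trans := ?_ }
      · intro a b h1 h2
        by_contra hne
        rcases rRel_total hBt hne with h | h
        · exact h1 h
        · exact h2 h
      · intro a h
        exact rRel_asymm hBt h h
      · intro a b c
        exact rRel_trans hN hBt hb
    · intro i j
      unfold rRel
      rw [cg_shift, ← wan_cg hBt (cg_add N i)]
      have := sRel_mul hBt 1 i j
      rw [one_mul] at this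
      rw [this]
      simp
    · intro i j
      refine ⟨rRel_neg hBt hs hB, fun h => ?_⟩
      simpa using rRel_neg hBt hs hB h
    · ext ⟨i, j⟩
      constructor
      · intro h
        have hT := hB h
        exact ⟨hT, Or.inl ⟨fun hc => hT.2 (cg_symm hc), Or.inr ⟨hT.1, h⟩⟩⟩
      · rintro ⟨hT, h⟩
        have h1 : i < j := hT.1
        rcases h with ⟨_, h⟩ | ⟨h, _⟩
        · rcases h with ⟨h, _⟩ | ⟨_, h⟩
          · simp only at h; omega
          · exact h
        · exact absurd (cg_symm h) hT.2
  · rintro ⟨r, hr, ht, hneg, rfl⟩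
    have irr : ∀ i, ¬ r i i := fun i => hr.irrefl i
    have tr : ∀ i j k, r i j → r j k → r i k := fun i j k => hr.trans i j k
    have tot : ∀ i j, i ≠ j → r i j ∨ r j i := by
      intro i j hne
      by_contra hc
      push Not at hc
      exact hne (hr.trichotomous i j hc.1 hc.2)
    refine ⟨⟨closed_of_order hN r irr tr tot ht, ?_⟩, ?_⟩
    · have := closed_of_order hN (fun a b => r b a) irr (fun i j k a b => tr _ _ _ b a)
        (fun i j h => (tot i j h).symm) (fun i j => ht j i)
      unfold IsCoclosedT
      convert this using 1
      ext ⟨i, j⟩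
      constructor
      · rintro ⟨hT, h⟩
        refine ⟨hT, ?_⟩
        rcases tot i j hT.1.ne with h' | h'
        · exact h'
        · exact absurd ⟨hT, h'⟩ h
      · rintro ⟨hT, h⟩
        exact ⟨hT, fun h' => irr _ (tr _ _ _ h h'.2)⟩
    · ext ⟨i, j⟩
      constructor
      · rintro ⟨hT, h⟩
        exact ⟨hT, (hneg _ _).2 h.2⟩
      · rintro ⟨hT, h⟩
        refine ⟨hT, ⟨?_, ?_⟩, (hneg _ _).1 h⟩
        · have := hT.1
          simp only at this ⊢; omega
        · intro hc
          exact hT.2 (cg_neg.1 hc)
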